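/- arXiv:2002.09862 — 9 statements merged into one kernel-verified Lean document; each statement's English description precedes it below -/
import Mathlib

section
/- Let (v_k), (d_k), (a_k) be three nonnegative real-valued adapted sequences on a filtered probability space, with each v_k and a_k integrable. If 𝔼[v_{k+1} | 𝓕_k] ≤ v_k + a_k − d_k almost surely for every k, and 𝔼[Σ_{k=1}^{∞} a_k] < ∞, then almost surely Σ_{k=1}^{∞} d_k < ∞ and v_k converges to a finite limit as k → ∞. -/
open MeasureTheory Filter

/-- Nonnegative integrable functions with summable integrals are almost everywhere summable. -/
theorem ae_summable_of_summable_integral {Ω : Type*} {m0 : MeasurableSpace Ω} {μ : Measure Ω}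
    {a : ℕ → Ω → ℝ} (ha_nonneg : ∀ k ω, 0 ≤ a k ω) (ha_int : ∀ k, Integrable (a k) μ)
    (ha_sum : Summable fun k => ∫ ω, a k ω ∂μ) : ∀ᵐ ω ∂μ, Summable fun k => a k ω := by
  have hmeas : ∀ k, AEMeasurable (fun ω => ENNReal.ofReal (a k ω)) μ := fun k =>
    (ha_int k).aemeasurable.ennreal_ofReal
  have hfin : ∫⁻ ω, ∑' k, ENNReal.ofReal (a k ω) ∂μ ≠ ⊤ := by
    rw [lintegral_tsum hmeas]
    simp_rw [← fun k => ofReal_integral_eq_lintegral_ofReal (ha_int k)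
      (ae_of_all _ (ha_nonneg k))]
    exact ha_sum.tsum_ofReal_ne_top
  filter_upwards [ae_lt_top' (AEMeasurable.tsum hmeas) hfin] with ω hω
  simpa [ENNReal.toReal_ofReal (ha_nonneg _ ω)] using ENNReal.summable_toReal hω.ne

/-- A supermartingale bounded in `L¹` converges almost everywhere. -/
theorem MeasureTheory.Supermartingale.exists_ae_tendsto_of_bdd_integral {Ω : Type*}
    {m0 : MeasurableSpace Ω} {μ : Measure Ω} [IsFiniteMeasure μ] {𝓕 : Filtration ℕ m0}
    {f : ℕ → Ω → ℝ} (hf : Supermartingale f 𝓕 μ) {C : ℝ} (hC : ∀ n, ∫ ω, ‖f n ω‖ ∂μ ≤ C) :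
    ∀ᵐ ω ∂μ, ∃ L : ℝ, Tendsto (fun n => f n ω) atTop (nhds L) := by
  have hbdd : ∀ n, eLpNorm ((-f) n) 1 μ ≤ C.toNNReal := fun n => by
    rw [Pi.neg_apply, eLpNorm_neg, eLpNorm_one_eq_lintegral_enorm,
      ← ofReal_integral_norm_eq_lintegral_enorm (hf.integrable n)]
    exact ENNReal.ofReal_le_ofReal (hC n)
  filter_upwards [hf.neg.exists_ae_tendsto_of_bdd hbdd] with ω ⟨L, hL⟩
  exact ⟨-L, by simpa using hL.neg⟩

/-- Let `(v_k)`, `(d_k)`, `(a_k)` be nonnegative adapted sequences with each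
`v_k`, `a_k` integrable.  If `𝔼[v_{k+1} | 𝓕_k] ≤ v_k + a_k − d_k` a.s. for every `k`, and
`𝔼[Σ_k a_k] < ∞` (equivalently `Σ_k 𝔼[a_k] < ∞` by nonnegativity), then almost surely
`Σ_k d_k < ∞` and `v_k` converges to a finite limit. -/
theorem stmt7 {Ω : Type*} {m0 : MeasurableSpace Ω} (ℙ : Measure Ω)
    [IsProbabilityMeasure ℙ] (𝓕 : Filtration ℕ m0)
    (v d a : ℕ → Ω → ℝ)
    (hv_adapt : ∀ k, Measurable[𝓕 k] (v k))
    (hd_adapt : ∀ k, Measurable[𝓕 k] (d k))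
    (ha_adapt : ∀ k, Measurable[𝓕 k] (a k))
    (hv_nonneg : ∀ k ω, 0 ≤ v k ω)
    (hd_nonneg : ∀ k ω, 0 ≤ d k ω)
    (ha_nonneg : ∀ k ω, 0 ≤ a k ω)
    (hv_int : ∀ k, Integrable (v k) ℙ)
    (ha_int : ∀ k, Integrable (a k) ℙ)
    (hcond : ∀ k, ℙ[v (k + 1)|𝓕 k] ≤ᵐ[ℙ] fun ω => v k ω + a k ω - d k ω)
    (ha_sum : Summable fun k => ∫ ω, a k ω ∂ℙ) :
    ∀ᵐ ω ∂ℙ, (Summable fun k => d k ω) ∧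
      ∃ L : ℝ, Tendsto (fun k => v k ω) atTop (nhds L) := by
  have hd_int : ∀ k, Integrable (d k) ℙ := fun k => by
    refine ((hv_int k).add (ha_int k)).mono'
      ((hd_adapt k).mono (𝓕.le k) le_rfl).aestronglyMeasurable ?_
    filter_upwards [hcond k, condExp_nonneg (m := 𝓕 k) (ae_of_all ℙ (hv_nonneg (k + 1)))]
      with ω h1 h2
    rw [Real.norm_of_nonneg (hd_nonneg k ω)]
    simp only [Pi.zero_apply, Pi.add_apply] at h2 ⊢
    linarith
  -- The compensated process `v_n + ∑_{j<n} (d_j - a_j)` is a supermartingale.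
  set S : ℕ → Ω → ℝ := fun n => ∑ j ∈ Finset.range n, (d j - a j) with hS
  have hS_int : ∀ n, Integrable (S n) ℙ := fun n =>
    integrable_finsetSum' _ fun j _ => (hd_int j).sub (ha_int j)
  have hS_meas : ∀ n m, n ≤ m + 1 → StronglyMeasurable[𝓕 m] (S n) := fun n m hnm =>
    Finset.stronglyMeasurable_sum _ fun j hj => by
      have hjm : 𝓕 j ≤ 𝓕 m := 𝓕.mono (by have := Finset.mem_range.1 hj; omega)
      exact ((hd_adapt j).stronglyMeasurable.mono hjm).sub
        ((ha_adapt j).stronglyMeasurable.mono hjm)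
  have hM_int : ∀ n, Integrable ((v + S) n) ℙ := fun n => (hv_int n).add (hS_int n)
  have hM : Supermartingale (v + S) 𝓕 ℙ := by
    refine supermartingale_nat
      (fun n => (hv_adapt n).stronglyMeasurable.add (hS_meas n n n.le_succ)) hM_int fun n => ?_
    filter_upwards [hcond n, condExp_add (hv_int (n + 1)) (hS_int (n + 1)) (𝓕 n)] with ω h1 h2
    rw [Pi.add_apply, h2, Pi.add_apply, condExp_of_stronglyMeasurable (𝓕.le n)
      (hS_meas (n + 1) n le_rfl) (hS_int (n + 1)), hS]
    simp only [Pi.add_apply, Finset.sum_range_succ, Pi.sub_apply]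
    linarith
  have hbdd : ∀ n, ∫ ω, ‖(v + S) n ω‖ ∂ℙ ≤ ∫ ω, (v + S) 0 ω ∂ℙ + 2 * ∑' k, ∫ ω, a k ω ∂ℙ := by
    intro n
    have hA_int : Integrable (fun ω => ∑ j ∈ Finset.range n, a j ω) ℙ :=
      integrable_finsetSum _ fun j _ => ha_int j
    calc ∫ ω, ‖(v + S) n ω‖ ∂ℙ
        ≤ ∫ ω, ((v + S) n ω + 2 * ∑ j ∈ Finset.range n, a j ω) ∂ℙ := by
          refine integral_mono (hM_int n).norm ((hM_int n).add (hA_int.const_mul 2)) fun ω => ?_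
          have hA : 0 ≤ ∑ j ∈ Finset.range n, a j ω := Finset.sum_nonneg fun j _ => ha_nonneg j ω
          have hD : 0 ≤ ∑ j ∈ Finset.range n, d j ω := Finset.sum_nonneg fun j _ => hd_nonneg j ω
          have hv := hv_nonneg n ω
          simp only [hS, Pi.add_apply, Finset.sum_apply, Pi.sub_apply, Finset.sum_sub_distrib,
            Real.norm_eq_abs]
          exact abs_le.2 ⟨by linarith, by linarith⟩
      _ = ∫ ω, (v + S) n ω ∂ℙ + 2 * ∑ j ∈ Finset.range n, ∫ ω, a j ω ∂ℙ := by
          rw [integral_add (hM_int n) (hA_int.const_mul 2), integral_const_mul,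
            integral_finsetSum _ fun j _ => ha_int j]
      _ ≤ _ := by
          have hM0 : ∫ ω, (v + S) n ω ∂ℙ ≤ ∫ ω, (v + S) 0 ω ∂ℙ := by
            simpa using hM.setIntegral_le n.zero_le MeasurableSet.univ
          have hA : ∑ j ∈ Finset.range n, ∫ ω, a j ω ∂ℙ ≤ ∑' k, ∫ ω, a k ω ∂ℙ :=
            ha_sum.sum_le_tsum _ fun j _ => integral_nonneg (ha_nonneg j)
          linarith
  filter_upwards [ae_summable_of_summable_integral ha_nonneg ha_int ha_sum,
    hM.exists_ae_tendsto_of_bdd_integral hbdd] with ω ha ⟨L, hL⟩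
  have hvd : Tendsto (fun n => v n ω + ∑ j ∈ Finset.range n, d j ω) atTop
      (nhds (L + ∑' j, a j ω)) := by
    refine (hL.add ha.hasSum.tendsto_sum_nat).congr fun n => ?_
    simp only [hS, Pi.add_apply, Finset.sum_apply, Pi.sub_apply, Finset.sum_sub_distrib]
    ring
  obtain ⟨B, hB⟩ := hvd.bddAbove_range
  have hd : Summable fun k => d k ω :=
    summable_of_sum_range_le (fun k => hd_nonneg k ω) fun n =>
      (le_add_of_nonneg_left (hv_nonneg n ω)).trans (hB ⟨n, rfl⟩)
  exact ⟨hd, _, (hvd.sub hd.hasSum.tendsto_sum_nat).congr fun n => by ring⟩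
end

section
/- If A ∈ ℝ^{N×N} is a doubly stochastic matrix, then the symmetric matrix 2I_N − A − Aᵀ is positive semidefinite, i.e. xᵀ(2I_N − A − Aᵀ)x ≥ 0 for all x ∈ ℝᴺ. -/
open Matrix

/-- If `A ∈ ℝ^{N×N}` is doubly stochastic, then `2I_N − A − Aᵀ` is positive
semidefinite: `xᵀ(2I_N − A − Aᵀ)x ≥ 0` for all `x ∈ ℝᴺ`. -/
theorem stmt8 (N : ℕ) (A : Matrix (Fin N) (Fin N) ℝ)
    (hA_nonneg : ∀ i j, 0 ≤ A i j)
    (hA_row : ∀ i, ∑ j, A i j = 1)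
    (hA_col : ∀ j, ∑ i, A i j = 1)
    (x : Fin N → ℝ) :
    0 ≤ x ⬝ᵥ (((2 : ℝ) • (1 : Matrix (Fin N) (Fin N) ℝ) - A - Aᵀ) *ᵥ x) := by
  have hrow : ∑ i, ∑ j, A i j * x i ^ 2 = x ⬝ᵥ x := by
    simp only [← Finset.sum_mul, hA_row, one_mul, dotProduct, sq]
  have hcol : ∑ i, ∑ j, A i j * x j ^ 2 = x ⬝ᵥ x := by
    rw [Finset.sum_comm]
    simp only [← Finset.sum_mul, hA_col, one_mul, dotProduct, sq]
  have hcross : ∑ i, ∑ j, A i j * (x i * x j) = x ⬝ᵥ (A *ᵥ x) := by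
    simp only [dotProduct, mulVec, Finset.mul_sum]
    exact Finset.sum_congr rfl fun i _ => Finset.sum_congr rfl fun j _ => by ring
  have htrans : x ⬝ᵥ (Aᵀ *ᵥ x) = x ⬝ᵥ (A *ᵥ x) := by
    rw [mulVec_transpose, dotProduct_comm, ← dotProduct_mulVec]
  have hsquares : ∑ i, ∑ j, A i j * (x i - x j) ^ 2 =
      x ⬝ᵥ x + x ⬝ᵥ x - 2 * (x ⬝ᵥ (A *ᵥ x)) := by
    nth_rewrite 1 [← hrow]
    rw [← hcol, ← hcross]
    simp only [Finset.mul_sum, ← Finset.sum_add_distrib, ← Finset.sum_sub_distrib]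
    exact Finset.sum_congr rfl fun i _ => Finset.sum_congr rfl fun j _ => by ring
  have hnonneg : 0 ≤ ∑ i, ∑ j, A i j * (x i - x j) ^ 2 :=
    Finset.sum_nonneg fun i _ => Finset.sum_nonneg fun j _ =>
      mul_nonneg (hA_nonneg i j) (sq_nonneg _)
  rw [sub_mulVec, sub_mulVec, smul_mulVec, one_mulVec, dotProduct_sub, dotProduct_sub,
    dotProduct_smul, htrans, smul_eq_mul]
  linarith
end

section
/- Let A ∈ ℝ^{N×N} be doubly stochastic with N ≥ 2, and let Q₁ ∈ ℝ^{(N−1)×N} satisfy Q₁ 1_N = 0 and Q₁ Q₁ᵀ = I_{N−1}. Then the matrix H = Q₁ A Q₁ᵀ − I_{N−1} has negative semidefinite symmetric part: uᵀ(H + Hᵀ)u ≤ 0 for all u ∈ ℝ^{N−1}. -/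
open Matrix

/-- The quadratic form of a doubly stochastic matrix is bounded by that of the identity. -/
theorem dotProduct_mulVec_le_dotProduct_self_of_sum_eq_one {n : Type*} [Fintype n]
    {A : Matrix n n ℝ} (hA_nonneg : ∀ i j, 0 ≤ A i j) (hA_row : ∀ i, ∑ j, A i j = 1)
    (hA_col : ∀ j, ∑ i, A i j = 1) (x : n → ℝ) : x ⬝ᵥ (A *ᵥ x) ≤ x ⬝ᵥ x := by
  have hrow : ∑ i, ∑ j, A i j * (x i * x i) = x ⬝ᵥ x := by
    simp_rw [← Finset.sum_mul, hA_row, one_mul, dotProduct]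
  have hcol : ∑ i, ∑ j, A i j * (x j * x j) = x ⬝ᵥ x := by
    rw [Finset.sum_comm]
    simp_rw [← Finset.sum_mul, hA_col, one_mul, dotProduct]
  have hform : x ⬝ᵥ (A *ᵥ x) = ∑ i, ∑ j, A i j * (x i * x j) := by
    simp only [dotProduct, mulVec, Finset.mul_sum]
    exact Finset.sum_congr rfl fun i _ => Finset.sum_congr rfl fun j _ => by ring
  have hle : ∑ i, ∑ j, 2 * (A i j * (x i * x j)) ≤
      ∑ i, ∑ j, (A i j * (x i * x i) + A i j * (x j * x j)) :=
    Finset.sum_le_sum fun i _ => Finset.sum_le_sum fun j _ => by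
      linarith [mul_nonneg (hA_nonneg i j) (sq_nonneg (x i - x j))]
  simp only [Finset.sum_add_distrib, ← Finset.mul_sum, hrow, hcol, ← hform] at hle
  linarith

/-- Let `A ∈ ℝ^{N×N}` be doubly stochastic with `N ≥ 2`, and let
`Q₁ ∈ ℝ^{(N−1)×N}` satisfy `Q₁ 1_N = 0` and `Q₁ Q₁ᵀ = I_{N−1}`.  Then
`H = Q₁ A Q₁ᵀ − I_{N−1}` has negative semidefinite symmetric part. -/
theorem stmt9 (N : ℕ) (hN : 2 ≤ N) (A : Matrix (Fin N) (Fin N) ℝ)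
    (hA_nonneg : ∀ i j, 0 ≤ A i j)
    (hA_row : ∀ i, ∑ j, A i j = 1)
    (hA_col : ∀ j, ∑ i, A i j = 1)
    (Q₁ : Matrix (Fin (N - 1)) (Fin N) ℝ)
    (hQ1 : Q₁ *ᵥ (fun _ => (1 : ℝ)) = 0)
    (hQQ : Q₁ * Q₁ᵀ = 1)
    (H : Matrix (Fin (N - 1)) (Fin (N - 1)) ℝ)
    (hH : H = Q₁ * A * Q₁ᵀ - 1) :
    ∀ u : Fin (N - 1) → ℝ, u ⬝ᵥ ((H + Hᵀ) *ᵥ u) ≤ 0 := by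
  intro u
  have hform : u ⬝ᵥ (H *ᵥ u) ≤ 0 := by
    have hle := dotProduct_mulVec_le_dotProduct_self_of_sum_eq_one hA_nonneg hA_row hA_col (Q₁ᵀ *ᵥ u)
    have hpull (v : Fin N → ℝ) : (Q₁ᵀ *ᵥ u) ⬝ᵥ v = u ⬝ᵥ (Q₁ *ᵥ v) := by
      rw [mulVec_transpose, dotProduct_mulVec]
    rw [hpull, hpull, mulVec_mulVec, mulVec_mulVec, mulVec_mulVec, hQQ, one_mulVec] at hle
    rw [hH, sub_mulVec, one_mulVec, dotProduct_sub, Matrix.mul_assoc]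
    simpa [Matrix.mul_assoc] using hle
  have htranspose : u ⬝ᵥ (Hᵀ *ᵥ u) = u ⬝ᵥ (H *ᵥ u) := by
    rw [mulVec_transpose, dotProduct_comm, dotProduct_mulVec]
  rw [add_mulVec, dotProduct_add, htranspose]
  linarith
end

section
/- Under the stated Markovian switching network model, set h = (m−1)² + 1 and H_i = Q₁ A_i Q₁ᵀ − I_{N−1}. Then there exists a constant γ₀ > 0 such that for every t ∈ ℕ, almost surely the conditional expectation of the sum of symmetrized matrices satisfies uᵀ 𝔼[ Σ_{k=t}^{t+h−1} (H_{θ(k)} + H_{θ(k)}ᵀ) | 𝓕_t ] u ≤ −γ₀ ‖u‖² for all u ∈ ℝ^{N−1} (the conditional expectation taken entrywise). -/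
open MeasureTheory Matrix Filter

/-- Some power below `card n` already witnesses a nonzero entry of a higher power
(a consequence of Cayley–Hamilton). -/
lemma Matrix.exists_lt_card_pow_apply_ne_zero {n R : Type*} [Fintype n] [DecidableEq n]
    [CommRing R] [Nontrivial R] (M : Matrix n n R) (i j : n) (k : ℕ) (hk : (M ^ k) i j ≠ 0) :
    ∃ r < Fintype.card n, (M ^ r) i j ≠ 0 := by
  by_contra! hzero
  apply hk
  have hdeg : (Polynomial.X ^ k %ₘ M.charpoly).natDegree < Fintype.card n := by
    have : Nonempty n := ⟨i⟩
    have hlt := Polynomial.natDegree_modByMonic_lt (Polynomial.X ^ k) M.charpoly_monic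
      (fun h1 => by simpa [h1, eq_comm] using M.charpoly_natDegree_eq_dim)
    rwa [M.charpoly_natDegree_eq_dim] at hlt
  rw [M.pow_eq_aeval_mod_charpoly k, Polynomial.aeval_eq_sum_range' hdeg, Matrix.sum_apply]
  refine Finset.sum_eq_zero fun r hr => ?_
  rw [Matrix.smul_apply, hzero r (Finset.mem_range.mp hr), smul_zero]

/-- The quadratic form of `1 - A` for doubly stochastic `A` as a sum over edges. -/
lemma Matrix.two_mul_dotProduct_mulVec_sub {n : Type*} [Fintype n] {A : Matrix n n ℝ}
    (hrow : ∀ i, ∑ j, A i j = 1) (hcol : ∀ j, ∑ i, A i j = 1) (v : n → ℝ) :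
    2 * (v ⬝ᵥ (A *ᵥ v) - v ⬝ᵥ v) = -∑ i, ∑ j, A i j * (v i - v j) ^ 2 := by
  have h1 : ∑ i, ∑ j, A i j * v i ^ 2 = v ⬝ᵥ v := by
    simp_rw [← Finset.sum_mul, hrow, dotProduct, one_mul, sq]
  have h2 : ∑ i, ∑ j, A i j * v j ^ 2 = v ⬝ᵥ v := by
    rw [Finset.sum_comm]
    simp_rw [← Finset.sum_mul, hcol, dotProduct, one_mul, sq]
  have h3 : ∑ i, ∑ j, A i j * (v i * v j) = v ⬝ᵥ (A *ᵥ v) := by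
    simp_rw [dotProduct, mulVec, dotProduct, Finset.mul_sum]
    exact Finset.sum_congr rfl fun i _ => Finset.sum_congr rfl fun j _ => by ring
  have h4 : ∑ i, ∑ j, A i j * (v i - v j) ^ 2
      = ∑ i, ∑ j, A i j * v i ^ 2 + ∑ i, ∑ j, A i j * v j ^ 2
        - 2 * ∑ i, ∑ j, A i j * (v i * v j) := by
    simp_rw [Finset.mul_sum, ← Finset.sum_add_distrib, ← Finset.sum_sub_distrib]
    exact Finset.sum_congr rfl fun i _ => Finset.sum_congr rfl fun j _ => by ring
  rw [h4, h1, h2, h3]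
  ring

/-- A negative definite quadratic form is uniformly negative definite. -/
lemma Matrix.exists_forall_dotProduct_mulVec_le {n : Type*} [Fintype n] (M : Matrix n n ℝ)
    (hM : ∀ u, u ≠ 0 → u ⬝ᵥ (M *ᵥ u) < 0) :
    ∃ γ : ℝ, 0 < γ ∧ ∀ u, u ⬝ᵥ (M *ᵥ u) ≤ -γ * (u ⬝ᵥ u) := by
  have hpos : ∀ u : n → ℝ, u ≠ 0 → 0 < u ⬝ᵥ u := fun u hu =>
    lt_of_le_of_ne (Finset.sum_nonneg fun i _ => mul_self_nonneg _)
      (fun h => hu (dotProduct_self_eq_zero.mp h.symm))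
  have hne : ∀ u ∈ Metric.sphere (0 : n → ℝ) 1, u ≠ 0 := by
    rintro u hu rfl
    simp at hu
  have hcont : ContinuousOn (fun u : n → ℝ => -(u ⬝ᵥ (M *ᵥ u)) / (u ⬝ᵥ u))
      (Metric.sphere 0 1) := by
    refine ContinuousOn.div ?_ ?_ fun u hu => (hpos u (hne u hu)).ne'
    · exact (continuous_id.dotProduct (continuous_const.matrix_mulVec continuous_id)).neg.continuousOn
    · exact (continuous_id.dotProduct continuous_id).continuousOn
  obtain ⟨γ, hγ, hle⟩ := (isCompact_sphere (0 : n → ℝ) 1).exists_forall_le' hcont (a := 0)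
    fun u hu => div_pos (neg_pos.mpr (hM u (hne u hu))) (hpos u (hne u hu))
  refine ⟨γ, hγ, fun u => ?_⟩
  rcases eq_or_ne u 0 with rfl | hu
  · simp
  have hnorm : ‖u‖ ≠ 0 := norm_ne_zero_iff.mpr hu
  have hw := hle (‖u‖⁻¹ • u) (by simp [norm_smul, hnorm])
  have hscale : -((‖u‖⁻¹ • u) ⬝ᵥ (M *ᵥ (‖u‖⁻¹ • u))) / ((‖u‖⁻¹ • u) ⬝ᵥ (‖u‖⁻¹ • u))
      = -(u ⬝ᵥ (M *ᵥ u)) / (u ⬝ᵥ u) := by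
    have := (hpos u hu).ne'
    simp only [mulVec_smul, smul_dotProduct, dotProduct_smul, smul_eq_mul]
    field_simp
  rw [hscale, le_div_iff₀ (hpos u hu)] at hw
  linarith

lemma integrable_comp_finite {Ω ι : Type*} {m0 : MeasurableSpace Ω} (ℙ : Measure Ω)
    [IsFiniteMeasure ℙ] [Finite ι] [MeasurableSpace ι] [DiscreteMeasurableSpace ι]
    {X : Ω → ι} (hX : Measurable X) (f : ι → ℝ) : Integrable (fun ω => f (X ω)) ℙ :=
  (Integrable.of_finite (μ := ℙ.map X)).comp_measurable hX

/-- Multi-step transition formula for functions of a finite Markov chain. -/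
lemma condExp_markov_comp {Ω ι : Type*} [Fintype ι] [DecidableEq ι] [MeasurableSpace ι]
    [DiscreteMeasurableSpace ι] {m0 : MeasurableSpace Ω} (ℙ : Measure Ω)
    [IsFiniteMeasure ℙ] (𝓕 : Filtration ℕ m0) (P : Matrix ι ι ℝ) (θ : ℕ → Ω → ι)
    (hadapt : ∀ k, Measurable[𝓕 k] (θ k))
    (hmarkov : ∀ k j, ℙ[Set.indicator {ω | θ (k + 1) ω = j} (fun _ => (1 : ℝ))|𝓕 k]
        =ᵐ[ℙ] fun ω => P (θ k ω) j) (t n : ℕ) (f : ι → ℝ) :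
    ℙ[fun ω => f (θ (t + n) ω)|𝓕 t] =ᵐ[ℙ] fun ω => ((P ^ n) *ᵥ f) (θ t ω) := by
  have hmeas : ∀ k, Measurable (θ k) := fun k => (hadapt k).mono (𝓕.le k) le_rfl
  have hstep : ∀ k (f : ι → ℝ), ℙ[fun ω => f (θ (k + 1) ω)|𝓕 k]
      =ᵐ[ℙ] fun ω => (P *ᵥ f) (θ k ω) := by
    intro k f
    have hdecomp : (fun ω => f (θ (k + 1) ω))
        = ∑ j, f j • Set.indicator {ω | θ (k + 1) ω = j} (fun _ => (1 : ℝ)) := by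
      ext ω
      simp [Finset.sum_apply, Set.indicator_apply]
    rw [hdecomp]
    have hint : ∀ j ∈ Finset.univ, Integrable
        (f j • Set.indicator {ω | θ (k + 1) ω = j} (fun _ => (1 : ℝ))) ℙ := fun j _ =>
      ((integrable_const 1).indicator (hmeas (k + 1) (measurableSet_singleton j))).smul (f j)
    have hall : ∀ᵐ ω ∂ℙ, ∀ j,
        (ℙ[f j • Set.indicator {ω | θ (k + 1) ω = j} (fun _ => (1 : ℝ))|𝓕 k]) ω
          = f j * P (θ k ω) j := by
      refine ae_all_iff.mpr fun j => ?_
      filter_upwards [condExp_smul (μ := ℙ) (f j)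
        (Set.indicator {ω | θ (k + 1) ω = j} (fun _ => (1 : ℝ))) (𝓕 k), hmarkov k j]
        with ω h1 h2
      rw [h1, Pi.smul_apply, h2, smul_eq_mul]
    filter_upwards [condExp_finsetSum hint (𝓕 k), hall] with ω h1 h2
    rw [h1, Finset.sum_apply]
    exact Finset.sum_congr rfl fun j _ => by rw [h2 j, mul_comm]
  induction n generalizing f with
  | zero =>
    have hsm : StronglyMeasurable[𝓕 t] (fun ω => f (θ t ω)) :=
      ((measurable_of_finite f).comp (hadapt t)).stronglyMeasurable
    rw [pow_zero, one_mulVec, add_zero, condExp_of_stronglyMeasurable (𝓕.le t) hsm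
      (integrable_comp_finite ℙ (hmeas t) f)]
  | succ n ih =>
    have htower := condExp_condExp_of_le (μ := ℙ) (f := fun ω => f (θ (t + n + 1) ω))
      (𝓕.mono (Nat.le_add_right t n)) (𝓕.le (t + n))
    rw [pow_succ, ← mulVec_mulVec]
    exact (htower.symm.trans (condExp_congr_ae (hstep (t + n) f))).trans (ih (P *ᵥ f))

/-- Under the Markovian switching model, with `h = (m−1)² + 1` and
`H_i = Q₁ A_i Q₁ᵀ − I_{N−1}`, there is `γ₀ > 0` such that for every `t`, almost surely
`uᵀ 𝔼[ Σ_{k=t}^{t+h−1} (H_{θ(k)} + H_{θ(k)}ᵀ) | 𝓕_t ] u ≤ −γ₀‖u‖²` for all `u ∈ ℝ^{N−1}`,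
the conditional expectation being taken entrywise. -/
theorem stmt11 {Ω : Type*} {m0 : MeasurableSpace Ω} (ℙ : Measure Ω)
    [IsProbabilityMeasure ℙ] (𝓕 : Filtration ℕ m0)
    (m : ℕ) (hm : 1 ≤ m)
    (P : Matrix (Fin m) (Fin m) ℝ)
    (hP_nonneg : ∀ i j, 0 ≤ P i j)
    (hP_row : ∀ i, ∑ j, P i j = 1)
    (hP_irr : ∀ i j, ∃ n : ℕ, 1 ≤ n ∧ 0 < (P ^ n) i j)
    (θ : ℕ → Ω → Fin m)
    (hθ_adapt : ∀ k, Measurable[𝓕 k] (θ k))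
    (hθ_markov : ∀ k (j : Fin m),
      ℙ[Set.indicator {ω | θ (k + 1) ω = j} (fun _ => (1 : ℝ))|𝓕 k]
        =ᵐ[ℙ] fun ω => P (θ k ω) j)
    (N : ℕ) (hN : 2 ≤ N)
    (A : Fin m → Matrix (Fin N) (Fin N) ℝ)
    (hA_nonneg : ∀ l i j, 0 ≤ A l i j)
    (hA_row : ∀ l i, ∑ j, A l i j = 1)
    (hA_col : ∀ l j, ∑ i, A l i j = 1)
    (hconn : ∀ i j : Fin N,
      Relation.ReflTransGen (fun u v : Fin N => ∃ l, 0 < A l v u) i j)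
    (Q₁ : Matrix (Fin (N - 1)) (Fin N) ℝ)
    (hQ1 : Q₁ *ᵥ (fun _ => (1 : ℝ)) = 0)
    (hQQ : Q₁ * Q₁ᵀ = 1)
    (H : Fin m → Matrix (Fin (N - 1)) (Fin (N - 1)) ℝ)
    (hH : ∀ i, H i = Q₁ * A i * Q₁ᵀ - 1)
    (h : ℕ) (hh : h = (m - 1) ^ 2 + 1) :
    ∃ γ₀ : ℝ, 0 < γ₀ ∧ ∀ t : ℕ, ∀ᵐ ω ∂ℙ,
      ∀ u : Fin (N - 1) → ℝ,
        u ⬝ᵥ ((Matrix.of fun i j =>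
            (ℙ[fun ω' => (∑ k ∈ Finset.Icc t (t + h - 1),
                (H (θ k ω') + (H (θ k ω'))ᵀ)) i j|𝓕 t]) ω) *ᵥ u)
          ≤ -γ₀ * (u ⬝ᵥ u) := by
  let S : Fin m → Matrix (Fin (N - 1)) (Fin (N - 1)) ℝ := fun l => H l + (H l)ᵀ
  let G : Fin m → Matrix (Fin (N - 1)) (Fin (N - 1)) ℝ := fun s =>
    ∑ n ∈ Finset.range h, ∑ l, (P ^ n) s l • S l
  have hS : ∀ l u, u ⬝ᵥ (S l *ᵥ u)
      = -∑ i, ∑ j, A l i j * ((Q₁ᵀ *ᵥ u) i - (Q₁ᵀ *ᵥ u) j) ^ 2 := by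
    intro l u
    have hadj : ∀ w, u ⬝ᵥ (Q₁ *ᵥ w) = (Q₁ᵀ *ᵥ u) ⬝ᵥ w := fun w => by
      rw [dotProduct_mulVec, mulVec_transpose]
    have hself : (Q₁ᵀ *ᵥ u) ⬝ᵥ (Q₁ᵀ *ᵥ u) = u ⬝ᵥ u := by
      rw [← hadj, mulVec_mulVec, hQQ, one_mulVec]
    have hquad : u ⬝ᵥ (H l *ᵥ u)
        = (Q₁ᵀ *ᵥ u) ⬝ᵥ (A l *ᵥ (Q₁ᵀ *ᵥ u)) - (Q₁ᵀ *ᵥ u) ⬝ᵥ (Q₁ᵀ *ᵥ u) := by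
      rw [hself, ← hadj, hH, sub_mulVec, dotProduct_sub, one_mulVec, mulVec_mulVec,
        mulVec_mulVec]
    have htrans : u ⬝ᵥ ((H l)ᵀ *ᵥ u) = u ⬝ᵥ (H l *ᵥ u) := by
      rw [mulVec_transpose, dotProduct_comm, ← dotProduct_mulVec]
    rw [← two_mul_dotProduct_mulVec_sub (hA_row l) (hA_col l), ← hquad, add_mulVec,
      dotProduct_add, htrans, two_mul]
  have hS_nonpos : ∀ l u, u ⬝ᵥ (S l *ᵥ u) ≤ 0 := fun l u => by
    rw [hS, neg_nonpos]
    exact Finset.sum_nonneg fun i _ => Finset.sum_nonneg fun j _ =>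
      mul_nonneg (hA_nonneg l i j) (sq_nonneg _)
  have hG : ∀ s u, u ⬝ᵥ (G s *ᵥ u)
      = ∑ n ∈ Finset.range h, ∑ l, (P ^ n) s l * (u ⬝ᵥ (S l *ᵥ u)) := fun s u => by
    simp only [G, sum_mulVec, dotProduct_sum, smul_mulVec, dotProduct_smul, smul_eq_mul]
  have hterm : ∀ s u n l, (P ^ n) s l * (u ⬝ᵥ (S l *ᵥ u)) ≤ 0 := fun s u n l =>
    mul_nonpos_of_nonneg_of_nonpos (pow_apply_nonneg hP_nonneg n s l) (hS_nonpos l u)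
  have hG_neg : ∀ s u, u ≠ 0 → u ⬝ᵥ (G s *ᵥ u) < 0 := by
    intro s u hu
    rw [hG]
    have hinner : ∀ n ∈ Finset.range h, ∑ l, (P ^ n) s l * (u ⬝ᵥ (S l *ᵥ u)) ≤ 0 :=
      fun n _ => Finset.sum_nonpos fun l _ => hterm s u n l
    refine lt_of_le_of_ne (Finset.sum_nonpos hinner) fun hzero => hu ?_
    have hS_zero : ∀ l, u ⬝ᵥ (S l *ᵥ u) = 0 := by
      intro l
      obtain ⟨k, -, hk⟩ := hP_irr s l
      obtain ⟨r, hr, hne⟩ := P.exists_lt_card_pow_apply_ne_zero s l k hk.ne'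
      rw [Fintype.card_fin] at hr
      have hrh : r ∈ Finset.range h := by
        rw [Finset.mem_range, hh]
        have := Nat.le_self_pow two_ne_zero (m - 1)
        omega
      have h1 := (Finset.sum_eq_zero_iff_of_nonpos hinner).mp hzero r hrh
      have h2 := (Finset.sum_eq_zero_iff_of_nonpos fun l _ => hterm s u r l).mp h1 l
        (Finset.mem_univ l)
      exact (mul_eq_zero.mp h2).resolve_left hne
    have hedge : ∀ l i j, 0 < A l i j → (Q₁ᵀ *ᵥ u) i = (Q₁ᵀ *ᵥ u) j := by
      intro l i j hij
      have hnn : ∀ i j, 0 ≤ A l i j * ((Q₁ᵀ *ᵥ u) i - (Q₁ᵀ *ᵥ u) j) ^ 2 := fun i j =>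
        mul_nonneg (hA_nonneg l i j) (sq_nonneg _)
      have h0 := neg_eq_zero.mp ((hS l u).symm.trans (hS_zero l))
      have h1 := (Finset.sum_eq_zero_iff_of_nonneg fun i _ =>
        Finset.sum_nonneg fun j _ => hnn i j).mp h0 i (Finset.mem_univ i)
      have h2 := (Finset.sum_eq_zero_iff_of_nonneg fun j _ => hnn i j).mp h1 j
        (Finset.mem_univ j)
      exact sub_eq_zero.mp (sq_eq_zero_iff.mp ((mul_eq_zero.mp h2).resolve_left hij.ne'))
    have hconst : ∀ i j, (Q₁ᵀ *ᵥ u) i = (Q₁ᵀ *ᵥ u) j := by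
      intro i j
      induction hconn i j with
      | refl => rfl
      | tail _ hstep ih =>
        obtain ⟨l, hl⟩ := hstep
        exact ih.trans (hedge l _ _ hl).symm
    let i₀ : Fin N := ⟨0, by omega⟩
    have hv : Q₁ᵀ *ᵥ u = (Q₁ᵀ *ᵥ u) i₀ • fun _ => (1 : ℝ) := by
      ext i
      simpa using hconst i i₀
    rw [← one_mulVec u, ← hQQ, ← mulVec_mulVec, hv, mulVec_smul, hQ1, smul_zero]
  choose γ hγ_pos hγ using fun s => (G s).exists_forall_dotProduct_mulVec_le (hG_neg s)
  obtain ⟨γ₀, hγ₀_lt, hγ₀_pos⟩ :=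
    ((eventually_all.mpr fun s => nhdsWithin_le_nhds (gt_mem_nhds (hγ_pos s))).and
      (self_mem_nhdsWithin (a := (0 : ℝ)) (s := Set.Ioi 0))).exists
  refine ⟨γ₀, hγ₀_pos, fun t => ?_⟩
  have hmeas : ∀ k, Measurable (θ k) := fun k => (hθ_adapt k).mono (𝓕.le k) le_rfl
  have hwindow : Finset.Icc t (t + h - 1) = (Finset.range h).map (addLeftEmbedding t) := by
    rw [Finset.range_eq_Ico, Finset.map_add_left_Ico]
    ext k
    simp only [Finset.mem_Icc, Finset.mem_Ico]
    omega
  have hcond : ∀ᵐ ω ∂ℙ, ∀ i j,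
      (ℙ[fun ω' => (∑ k ∈ Finset.Icc t (t + h - 1),
        (H (θ k ω') + (H (θ k ω'))ᵀ)) i j|𝓕 t]) ω = G (θ t ω) i j := by
    refine ae_all_iff.mpr fun i => ae_all_iff.mpr fun j => ?_
    have hsum : (fun ω' => (∑ k ∈ Finset.Icc t (t + h - 1),
        (H (θ k ω') + (H (θ k ω'))ᵀ)) i j)
        = ∑ n ∈ Finset.range h, fun ω' => S (θ (t + n) ω') i j := by
      ext ω'
      rw [hwindow, Finset.sum_map, Matrix.sum_apply, Finset.sum_apply]
      rfl
    rw [hsum]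
    have hall : ∀ᵐ ω ∂ℙ, ∀ n, (ℙ[fun ω' => S (θ (t + n) ω') i j|𝓕 t]) ω
        = ((P ^ n) *ᵥ fun l => S l i j) (θ t ω) := ae_all_iff.mpr fun n =>
      condExp_markov_comp ℙ 𝓕 P θ hθ_adapt hθ_markov t n fun l => S l i j
    filter_upwards [condExp_finsetSum (s := Finset.range h)
      (fun n _ => integrable_comp_finite ℙ (hmeas (t + n)) fun l => S l i j) (𝓕 t), hall]
      with ω h1 h2
    rw [h1, Finset.sum_apply]
    simp only [h2, G, Matrix.sum_apply, Matrix.smul_apply, mulVec, dotProduct, smul_eq_mul]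
  filter_upwards [hcond] with ω hω u
  have hmat : (Matrix.of fun i j => (ℙ[fun ω' => (∑ k ∈ Finset.Icc t (t + h - 1),
      (H (θ k ω') + (H (θ k ω'))ᵀ)) i j|𝓕 t]) ω) = G (θ t ω) :=
    Matrix.ext hω
  rw [hmat]
  refine (hγ (θ t ω) u).trans ?_
  exact mul_le_mul_of_nonneg_right (neg_le_neg (hγ₀_lt (θ t ω)).le)
    (Finset.sum_nonneg fun i _ => mul_self_nonneg (u i))
end

section
/- Under the stated Markovian switching network model with m ≥ 2, let ζ = min{ P_{ij} : P_{ij} > 0 } be the smallest positive entry of the transition matrix and set h = (m−1)² + 1. Then for every t ∈ ℕ, almost surely 𝔼[ 1_B | 𝓕_t ] ≥ ζ^h, where B is the event that the chain visits every state during the window [t, t+h−1], i.e. B = { ω : for every state j ∈ {1,…,m} there exists k with t ≤ k ≤ t+h−1 and θ(k)(ω) = j }. -/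
open MeasureTheory Filter

/-- The set of outcomes whose trajectory from time `t` on begins with the list `l`. -/
def trajectoryPrefix {Ω S : Type*} (θ : ℕ → Ω → S) : List S → ℕ → Set Ω
  | [], _ => Set.univ
  | a :: l, t => {ω | θ t ω = a} ∩ trajectoryPrefix θ l (t + 1)

theorem exists_time_of_mem_trajectoryPrefix {Ω S : Type*} {θ : ℕ → Ω → S} {ω : Ω} {j : S} :
    ∀ {l : List S} {t : ℕ}, ω ∈ trajectoryPrefix θ l t → j ∈ l →
      ∃ k, t ≤ k ∧ k < t + l.length ∧ θ k ω = j
  | [], _, _, hj => by simp at hj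
  | a :: l, t, hω, hj => by
    rcases List.mem_cons.1 hj with rfl | hj
    · exact ⟨t, le_rfl, by simp, hω.1⟩
    · obtain ⟨k, hk, hk', hkj⟩ := exists_time_of_mem_trajectoryPrefix hω.2 hj
      exact ⟨k, by lia, by simp only [List.length_cons]; lia, hkj⟩

theorem measurableSet_trajectoryPrefix {Ω S : Type*} [MeasurableSpace Ω] [MeasurableSpace S]
    [MeasurableSingletonClass S] {θ : ℕ → Ω → S} (hθ : ∀ k, Measurable (θ k)) :
    ∀ (l : List S) (t : ℕ), MeasurableSet (trajectoryPrefix θ l t)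
  | [], _ => MeasurableSet.univ
  | a :: l, t => (hθ t (measurableSet_singleton a)).inter
      (measurableSet_trajectoryPrefix hθ l (t + 1))

/-- Two related points are joined by a chain without repetitions. -/
theorem Relation.ReflTransGen.exists_nodup_isChain {S : Type*} {r : S → S → Prop} {a c : S}
    (hac : Relation.ReflTransGen r a c) :
    ∃ l, List.IsChain r (a :: l) ∧ (a :: l).Nodup ∧ (a :: l).getLast? = some c := by
  induction hac using Relation.ReflTransGen.head_induction_on with
  | refl => exact ⟨[], by simp⟩
  | @head a b hab _ ih =>
    obtain ⟨l, hl, hnd, hlast⟩ := ih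
    by_cases ha : a ∈ b :: l
    · obtain ⟨s, u, hsu⟩ := List.append_of_mem ha
      rw [hsu] at hl hnd hlast
      exact ⟨u, hl.right_of_append, hnd.of_append_right, by simpa using hlast⟩
    · exact ⟨b :: l, List.isChain_cons_cons.2 ⟨hab, hl⟩, List.nodup_cons.2 ⟨ha, hnd⟩, by
        simpa using hlast⟩

/-- If all points of a finite type are joined by chains, then chains of length `n * (card - 1)`
suffice to visit `n + 1` points. -/
theorem exists_isChain_card_toFinset {S : Type*} [Fintype S] [DecidableEq S]
    {r : S → S → Prop} (hr : ∀ a b, Relation.ReflTransGen r a b) (i : S) (n : ℕ)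
    (hn : n + 1 ≤ Fintype.card S) :
    ∃ l, List.IsChain r (i :: l) ∧ l.length ≤ n * (Fintype.card S - 1) ∧
      n + 1 ≤ (i :: l).toFinset.card := by
  induction n with
  | zero => exact ⟨[], by simp⟩
  | succ n ih =>
    obtain ⟨l, hl, hlen, hcard⟩ := ih (by lia)
    by_cases hall : ∀ j, j ∈ (i :: l).toFinset
    · refine ⟨l, hl, hlen.trans (Nat.mul_le_mul_right _ n.le_succ), ?_⟩
      rwa [Finset.eq_univ_iff_forall.2 hall, Finset.card_univ]
    · push Not at hall
      obtain ⟨j, hj⟩ := hall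
      obtain ⟨u, hu, hnd, hlast⟩ :=
        (hr ((i :: l).getLast (List.cons_ne_nil i l)) j).exists_nodup_isChain
      have hulen : u.length ≤ Fintype.card S - 1 := by
        have := hnd.length_le_card
        simp only [List.length_cons] at this
        lia
      have hju : j ∈ (i :: (l ++ u)).toFinset := by
        have := List.mem_of_getLast? hlast
        rw [List.mem_cons] at this
        rw [List.mem_toFinset, ← List.cons_append, List.mem_append]
        rcases this with h | h
        · exact Or.inl (h ▸ List.getLast_mem _)
        · exact Or.inr h
      refine ⟨l ++ u, ?_, ?_, ?_⟩
      · have hsplit := List.dropLast_append_getLast (List.cons_ne_nil i l)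
        rw [← List.cons_append, ← hsplit]
        exact List.IsChain.append_overlap (by rwa [hsplit]) hu (List.cons_ne_nil _ _)
      · rw [List.length_append, Nat.succ_mul]
        lia
      · have hsub : insert j (i :: l).toFinset ⊆ (i :: (l ++ u)).toFinset := by
          refine Finset.insert_subset hju fun x hx => ?_
          rw [List.mem_toFinset] at hx ⊢
          rw [← List.cons_append]
          exact List.mem_append_left u hx
        have := Finset.card_le_card hsub
        rw [Finset.card_insert_of_notMem hj] at this
        lia

theorem exists_isChain_forall_mem {S : Type*} [Fintype S]
    {r : S → S → Prop} (hr : ∀ a b, Relation.ReflTransGen r a b) (i : S) :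
    ∃ l, List.IsChain r (i :: l) ∧ l.length ≤ (Fintype.card S - 1) ^ 2 ∧ ∀ j, j ∈ i :: l := by
  classical
  have hpos : 0 < Fintype.card S := Fintype.card_pos_iff.2 ⟨i⟩
  obtain ⟨l, hl, hlen, hcard⟩ :=
    exists_isChain_card_toFinset hr i (Fintype.card S - 1) (by lia)
  refine ⟨l, hl, by rwa [sq], fun j => ?_⟩
  have huniv : (i :: l).toFinset = Finset.univ :=
    Finset.eq_univ_of_card _ (le_antisymm (Finset.card_le_univ _) (by lia))
  exact List.mem_toFinset.1 (huniv ▸ Finset.mem_univ j)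

theorem Matrix.reflTransGen_of_pow_apply_ne_zero {S R : Type*} [Fintype S] [DecidableEq S]
    [Semiring R] {P : Matrix S S R} (n : ℕ) {i j : S} (hij : (P ^ n) i j ≠ 0) :
    Relation.ReflTransGen (fun a b => P a b ≠ 0) i j := by
  induction n generalizing j with
  | zero =>
    by_cases h : i = j
    · exact h ▸ .refl
    · simp [h] at hij
  | succ n ih =>
    rw [pow_succ, Matrix.mul_apply] at hij
    obtain ⟨k, -, hk⟩ := Finset.exists_ne_zero_of_sum_ne_zero hij
    exact (ih (left_ne_zero_of_mul hk)).tail (right_ne_zero_of_mul hk)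

/-- A Markov chain whose positive transition probabilities are at least `ζ` follows an admissible
chain of states with conditional probability at least `ζ` to the number of transitions. -/
theorem pow_length_le_condExp_trajectoryPrefix {Ω S : Type*} {m0 : MeasurableSpace Ω}
    [MeasurableSpace S] [MeasurableSingletonClass S] (μ : Measure Ω) [IsFiniteMeasure μ]
    (𝓕 : Filtration ℕ m0) (P : S → S → ℝ) (θ : ℕ → Ω → S)
    (hθ_adapt : ∀ k, Measurable[𝓕 k] (θ k))
    (hθ_markov : ∀ k j,
      μ[Set.indicator {ω | θ (k + 1) ω = j} (fun _ => (1 : ℝ))|𝓕 k]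
        =ᵐ[μ] fun ω => P (θ k ω) j)
    {ζ : ℝ} (hζ : 0 ≤ ζ) (l : List S) (i : S) (t : ℕ)
    (hl : List.IsChain (fun a b => ζ ≤ P a b) (i :: l)) :
    ∀ᵐ ω ∂μ, θ t ω = i →
      ζ ^ l.length ≤
        (μ[(trajectoryPrefix θ (i :: l) t).indicator (fun _ => (1 : ℝ))|𝓕 t]) ω := by
  have hθ : ∀ k, Measurable (θ k) := fun k => (hθ_adapt k).mono (𝓕.le k) le_rfl
  have hint : ∀ s, MeasurableSet s → Integrable (s.indicator (fun _ => (1 : ℝ))) μ :=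
    fun s hs => (integrable_const 1).indicator hs
  have hstate : ∀ k a, MeasurableSet[𝓕 k] {ω | θ k ω = a} :=
    fun k a => hθ_adapt k (measurableSet_singleton a)
  induction l generalizing i t with
  | nil =>
    rw [trajectoryPrefix, trajectoryPrefix, Set.inter_univ,
      condExp_of_stronglyMeasurable (𝓕.le t) (stronglyMeasurable_const.indicator (hstate t i))
        (hint _ (𝓕.le t _ (hstate t i)))]
    refine .of_forall fun ω hω => ?_
    simp [hω]
  | cons b l ih =>
    obtain ⟨hib, hbl⟩ := List.isChain_cons_cons.1 hl
    set A := trajectoryPrefix θ (b :: l) (t + 1) with hA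
    have hAm : MeasurableSet A := measurableSet_trajectoryPrefix hθ _ _
    have hnext : ζ ^ l.length • {ω | θ (t + 1) ω = b}.indicator (fun _ => (1 : ℝ)) ≤ᵐ[μ]
        μ[A.indicator (fun _ => (1 : ℝ))|𝓕 (t + 1)] := by
      have hnonneg : 0 ≤ᵐ[μ] μ[A.indicator (fun _ => (1 : ℝ))|𝓕 (t + 1)] :=
        condExp_nonneg (.of_forall fun ω => Set.indicator_nonneg (fun _ _ => zero_le_one) ω)
      filter_upwards [ih b (t + 1) hbl, hnonneg] with ω hω hω0
      by_cases hb : θ (t + 1) ω = b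
      · simpa [hb] using hω hb
      · simpa [hb] using hω0
    have hmono := condExp_mono (m := 𝓕 t)
      ((hint _ (𝓕.le _ _ (hstate (t + 1) b))).smul (ζ ^ l.length)) integrable_condExp hnext
    have htower := condExp_condExp_of_le (μ := μ) (f := A.indicator (fun _ => (1 : ℝ)))
      (𝓕.mono t.le_succ) (𝓕.le (t + 1))
    have hsmul := condExp_smul (μ := μ) (ζ ^ l.length)
      ({ω | θ (t + 1) ω = b}.indicator (fun _ => (1 : ℝ))) (𝓕 t)
    have hpull := condExp_indicator (hint A hAm) (hstate t i)
    rw [trajectoryPrefix, ← hA, ← Set.indicator_indicator]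
    filter_upwards [hmono, htower, hsmul, hpull, hθ_markov t b] with ω h1 h2 h3 h4 h5 hi
    rw [h4, Set.indicator_of_mem (show ω ∈ {ω | θ t ω = i} from hi), ← h2]
    refine le_trans ?_ h1
    rw [h3, Pi.smul_apply, h5, hi, List.length_cons, pow_succ, smul_eq_mul]
    exact mul_le_mul_of_nonneg_left hib (pow_nonneg hζ _)

/-- Under the Markovian switching model with `m ≥ 2`, let `ζ` be the smallest
positive entry of the transition matrix `P` and set `h = (m−1)² + 1`.  Then for every `t`, almost
surely `𝔼[1_B | 𝓕_t] ≥ ζ^h`, where `B` is the event that the chain visits every state during the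
window `[t, t+h−1]`. -/
theorem stmt12 {Ω : Type*} {m0 : MeasurableSpace Ω} (ℙ : Measure Ω)
    [IsProbabilityMeasure ℙ] (𝓕 : Filtration ℕ m0)
    (m : ℕ) (hm : 2 ≤ m)
    (P : Matrix (Fin m) (Fin m) ℝ)
    (hP_nonneg : ∀ i j, 0 ≤ P i j)
    (hP_row : ∀ i, ∑ j, P i j = 1)
    (hP_irr : ∀ i j, ∃ n : ℕ, 1 ≤ n ∧ 0 < (P ^ n) i j)
    (θ : ℕ → Ω → Fin m)
    (hθ_adapt : ∀ k, Measurable[𝓕 k] (θ k))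
    (hθ_markov : ∀ k (j : Fin m),
      ℙ[Set.indicator {ω | θ (k + 1) ω = j} (fun _ => (1 : ℝ))|𝓕 k]
        =ᵐ[ℙ] fun ω => P (θ k ω) j)
    (ζ : ℝ) (hζ : IsLeast {r : ℝ | 0 < r ∧ ∃ i j, P i j = r} ζ)
    (h : ℕ) (hh : h = (m - 1) ^ 2 + 1) :
    ∀ t : ℕ, ∀ᵐ ω ∂ℙ,
      ζ ^ h ≤
        (ℙ[Set.indicator
            {ω' | ∀ j : Fin m, ∃ k, t ≤ k ∧ k ≤ t + h - 1 ∧ θ k ω' = j}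
            (fun _ => (1 : ℝ))|𝓕 t]) ω := by
  intro t
  obtain ⟨⟨hζ_pos, i₀, j₀, hζ_eq⟩, hζ_le⟩ := hζ
  have hζ_one : ζ ≤ 1 := by
    rw [← hζ_eq, ← hP_row i₀]
    exact Finset.single_le_sum (fun j _ => hP_nonneg i₀ j) (Finset.mem_univ j₀)
  have hconn : ∀ a b, Relation.ReflTransGen (fun a b => ζ ≤ P a b) a b := fun a b => by
    obtain ⟨n, -, hn⟩ := hP_irr a b
    exact Relation.ReflTransGen.mono
      (fun c d hcd => hζ_le ⟨(hP_nonneg c d).lt_of_ne' hcd, c, d, rfl⟩)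
      _ _ (Matrix.reflTransGen_of_pow_apply_ne_zero n hn.ne')
  have hθ : ∀ k, Measurable (θ k) := fun k => (hθ_adapt k).mono (𝓕.le k) le_rfl
  choose l hchain hlen hmem using exists_isChain_forall_mem hconn
  simp only [Fintype.card_fin] at hlen
  set B : Set Ω := {ω' | ∀ j : Fin m, ∃ k, t ≤ k ∧ k ≤ t + h - 1 ∧ θ k ω' = j} with hB
  have hBm : MeasurableSet B := by
    have : B = ⋂ j, ⋃ k, ⋃ (_ : t ≤ k ∧ k ≤ t + h - 1), θ k ⁻¹' {j} := by
      ext ω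
      simp [hB, and_assoc]
    rw [this]
    exact .iInter fun j => .iUnion fun k => .iUnion fun _ => hθ k (measurableSet_singleton j)
  have hsub : ∀ i, trajectoryPrefix θ (i :: l i) t ⊆ B := fun i ω hω j => by
    obtain ⟨k, hk, hk', hkj⟩ := exists_time_of_mem_trajectoryPrefix hω (hmem i j)
    have := hlen i
    simp only [List.length_cons] at hk'
    exact ⟨k, hk, by lia, hkj⟩
  have hfollow := ae_all_iff.2 fun i => pow_length_le_condExp_trajectoryPrefix ℙ 𝓕 P θ hθ_adapt
    hθ_markov hζ_pos.le (l i) i t (hchain i)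
  have hmono := ae_all_iff.2 fun i => condExp_mono (μ := ℙ) (m := 𝓕 t)
    ((integrable_const (1 : ℝ)).indicator (measurableSet_trajectoryPrefix hθ (i :: l i) t))
    ((integrable_const (1 : ℝ)).indicator hBm)
    (.of_forall (Set.indicator_le_indicator_of_subset (hsub i) fun _ => zero_le_one))
  filter_upwards [hfollow, hmono] with ω h1 h2
  calc ζ ^ h ≤ ζ ^ (l (θ t ω)).length :=
        pow_le_pow_of_le_one hζ_pos.le hζ_one (by have := hlen (θ t ω); lia)
    _ ≤ _ := h1 _ rfl
    _ ≤ _ := h2 _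
end

section
/- Let 0 < δ₁ < 1, let δ₂ > δ₁, let c > 0 and a > 0. Then lim_{y→∞} e^{−c·y^{1−δ₁}} · ∫_a^y x^{−δ₂} e^{c·x^{1−δ₁}} dx = 0. -/
open Filter

/-- If `f = o(G')` with `G' ≥ 0` and `G → ∞`, then `∫ₐʸ f = o(G y)` as `y → ∞`. -/
theorem isLittleO_intervalIntegral_of_isLittleO_deriv {f G G' : ℝ → ℝ} {a : ℝ}
    (hf : ContinuousOn f (Set.Ici a)) (hG : ∀ x ∈ Set.Ici a, HasDerivAt G (G' x) x)
    (hG' : ContinuousOn G' (Set.Ici a)) (hG'0 : ∀ x ∈ Set.Ici a, 0 ≤ G' x)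
    (hGtop : Tendsto G atTop atTop) (hfG : f =o[atTop] G') :
    (fun y => ∫ x in a..y, f x) =o[atTop] G := by
  have intervalIntegrable {g : ℝ → ℝ} (hg : ContinuousOn g (Set.Ici a)) {u v : ℝ}
      (hu : a ≤ u) (huv : u ≤ v) : IntervalIntegrable g MeasureTheory.volume u v := by
    refine (hg.mono fun x hx => ?_).intervalIntegrable_of_Icc huv
    exact hu.trans hx.1
  refine Asymptotics.isLittleO_iff.2 fun ε hε => ?_
  obtain ⟨N, hN⟩ := eventually_atTop.1
    ((hfG.bound (half_pos hε)).and (eventually_ge_atTop a))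
  have haN : a ≤ N := (hN N le_rfl).2
  filter_upwards [eventually_ge_atTop N, hGtop.eventually_ge_atTop 0,
    hGtop.eventually_ge_atTop ((‖∫ x in a..N, f x‖ - ε / 2 * G N) / (ε / 2))]
    with y hy hGy hGy'
  rw [div_le_iff₀ (half_pos hε)] at hGy'
  have tail : ‖∫ x in N..y, f x‖ ≤ ε / 2 * (G y - G N) := by
    have hFTC : ∫ x in N..y, G' x = G y - G N := by
      refine intervalIntegral.integral_eq_sub_of_hasDerivAt (fun x hx => ?_)
        (intervalIntegrable hG' haN hy)
      rw [Set.uIcc_of_le hy] at hx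
      exact hG x (haN.trans hx.1)
    rw [← hFTC, ← intervalIntegral.integral_const_mul]
    refine intervalIntegral.norm_integral_le_of_norm_le hy (MeasureTheory.ae_of_all _ fun x hx => ?_)
      ((intervalIntegrable hG' haN hy).const_mul _)
    have hx' := hN x hx.1.le
    simpa only [Real.norm_of_nonneg (hG'0 x hx'.2)] using hx'.1
  rw [← intervalIntegral.integral_add_adjacent_intervals
    (intervalIntegrable hf le_rfl haN) (intervalIntegrable hf haN hy), Real.norm_of_nonneg hGy]
  refine (norm_add_le _ _).trans ?_
  linarith

/-- Real powers with distinct exponents are asymptotically ordered at infinity. -/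
theorem isLittleO_rpow_rpow_atTop_of_lt {p q : ℝ} (hpq : p < q) :
    (fun x : ℝ => x ^ p) =o[atTop] fun x => x ^ q := by
  have hne : ∀ᶠ x : ℝ in atTop, x ^ q = 0 → x ^ p = 0 := by
    filter_upwards [eventually_gt_atTop 0] with x hx h
    exact absurd h (Real.rpow_pos_of_pos hx q).ne'
  refine (Asymptotics.isLittleO_iff_tendsto' hne).2 ?_
  refine (tendsto_rpow_neg_atTop (sub_pos.2 hpq)).congr' ?_
  filter_upwards [eventually_gt_atTop 0] with x hx
  rw [neg_sub, Real.rpow_sub hx]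

/-- Let `0 < δ₁ < 1`, `δ₂ > δ₁`, `c > 0` and `a > 0`. Then
`lim_{y→∞} exp(−c·y^(1−δ₁)) · ∫_a^y x^(−δ₂) exp(c·x^(1−δ₁)) dx = 0`. -/
theorem stmt15 (δ₁ δ₂ c a : ℝ) (hδ₁0 : 0 < δ₁) (hδ₁1 : δ₁ < 1) (hδ : δ₁ < δ₂)
    (hc : 0 < c) (ha : 0 < a) :
    Tendsto
      (fun y : ℝ =>
        Real.exp (-(c * y ^ (1 - δ₁))) *
          ∫ x in a..y, x ^ (-δ₂) * Real.exp (c * x ^ (1 - δ₁)))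
      atTop (nhds 0) := by
  have hδ₁ : 0 < 1 - δ₁ := sub_pos.2 hδ₁1
  have hpow (p : ℝ) : ContinuousOn (fun x : ℝ => x ^ p) (Set.Ici a) :=
    continuousOn_id.rpow_const fun x hx => Or.inl (ha.trans_le hx).ne'
  have hexp : ContinuousOn (fun x : ℝ => Real.exp (c * x ^ (1 - δ₁))) (Set.Ici a) :=
    (continuousOn_const.mul (hpow _)).rexp
  have key : (fun y => ∫ x in a..y, x ^ (-δ₂) * Real.exp (c * x ^ (1 - δ₁)))
      =o[atTop] fun y => Real.exp (c * y ^ (1 - δ₁)) := by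
    refine isLittleO_intervalIntegral_of_isLittleO_deriv
      (G' := fun x => (c * (1 - δ₁)) * (x ^ (-δ₁) * Real.exp (c * x ^ (1 - δ₁))))
      ((hpow _).mul hexp) (fun x hx => ?_) (continuousOn_const.mul ((hpow _).mul hexp))
      (fun x hx => ?_) ?_ ?_
    · have hx0 : x ≠ 0 := (ha.trans_le hx).ne'
      convert ((Real.hasDerivAt_rpow_const (p := 1 - δ₁) (Or.inl hx0)).const_mul c).exp using 1
      rw [sub_sub_cancel_left]
      ring
    · have hx0 : 0 < x := ha.trans_le hx
      positivity
    · exact Real.tendsto_exp_atTop.comp ((tendsto_rpow_atTop hδ₁).const_mul_atTop hc)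
    · refine Asymptotics.IsLittleO.const_mul_right (mul_pos hc hδ₁).ne' ?_
      exact (isLittleO_rpow_rpow_atTop_of_lt (neg_lt_neg hδ)).mul_isBigO (Asymptotics.isBigO_refl _ _)
  refine key.tendsto_div_nhds_zero.congr fun y => ?_
  rw [Real.exp_neg, div_eq_inv_mul]
end

section
/- Let 0 < δ₁ < 1, let δ₂ > δ₁, let c > 0 and a > 0, and set η = δ₂ − δ₁. Then lim_{y→∞} y^{η} · e^{−c·y^{1−δ₁}} · ∫_a^y x^{−δ₂} e^{c·x^{1−δ₁}} dx = 1/(c·(1−δ₁)). In particular the ratio (∫_a^y x^{−δ₂} e^{c·x^{1−δ₁}} dx) / e^{c·y^{1−δ₁}} is O(y^{−(δ₂−δ₁)}) as y → ∞. -/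
open Filter Asymptotics

/-- Little-o relations between derivatives integrate at infinity, provided the dominating
function has eventually nonnegative derivative and tends to infinity. -/
theorem isLittleO_atTop_of_hasDerivAt {f f' g g' : ℝ → ℝ}
    (hf : ∀ᶠ x in atTop, HasDerivAt f (f' x) x) (hg : ∀ᶠ x in atTop, HasDerivAt g (g' x) x)
    (hg' : ∀ᶠ x in atTop, 0 ≤ g' x) (hfg : f' =o[atTop] g') (hg_top : Tendsto g atTop atTop) :
    f =o[atTop] g := by
  rw [isLittleO_iff]
  intro ε hε
  obtain ⟨N, hN⟩ := eventually_atTop.1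
    (hf.and (hg.and (hg'.and (isLittleO_iff.1 hfg (half_pos hε)))))
  have key : ∀ y, N ≤ y → ‖f y - f N‖ ≤ ε / 2 * (g y - g N) := by
    intro y hy
    refine image_norm_le_of_norm_deriv_right_le_deriv_boundary' (a := N) (b := y)
      (f := fun x => f x - f N) (f' := f')
      (B := fun x => ε / 2 * (g x - g N)) (B' := fun x => ε / 2 * g' x)
      ?_ ?_ ?_ ?_ ?_ ?_ (Set.right_mem_Icc.2 hy)
    · exact fun x hx => ((hN x hx.1).1.sub_const _).continuousAt.continuousWithinAt
    · exact fun x hx => ((hN x hx.1).1.sub_const _).hasDerivWithinAt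
    · simp
    · exact fun x hx =>
        (((hN x hx.1).2.1.sub_const _).const_mul _).continuousAt.continuousWithinAt
    · exact fun x hx => (((hN x hx.1).2.1.sub_const _).const_mul _).hasDerivWithinAt
    · intro x hx
      obtain ⟨-, -, h0, h⟩ := hN x hx.1
      rwa [Real.norm_of_nonneg h0] at h
  filter_upwards [eventually_ge_atTop N, hg_top.eventually_ge_atTop 0,
    hg_top.eventually_ge_atTop ((‖f N‖ - ε / 2 * g N) / (ε / 2))] with y hy h0 hlarge
  rw [div_le_iff₀ (half_pos hε)] at hlarge
  rw [Real.norm_of_nonneg h0]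
  have htri := norm_le_norm_add_norm_sub' (f y) (f N)
  linarith [key y hy]

/-- The exponential of a positive power, times an arbitrary power, tends to infinity. -/
theorem tendsto_rpow_mul_exp_mul_rpow_atTop (s : ℝ) {c p : ℝ} (hc : 0 < c) (hp : 0 < p) :
    Tendsto (fun x : ℝ => x ^ s * Real.exp (c * x ^ p)) atTop atTop := by
  refine ((tendsto_exp_mul_div_rpow_atTop (-s / p) c hc).comp
    (tendsto_rpow_atTop hp)).congr' ?_
  filter_upwards [eventually_gt_atTop 0] with x hx
  rw [Function.comp_apply, ← Real.rpow_mul hx.le, mul_div_cancel₀ _ hp.ne', Real.rpow_neg hx.le,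
    div_inv_eq_mul, mul_comm]

theorem hasDerivAt_rpow_mul_exp_mul_rpow (s c p : ℝ) {x : ℝ} (hx : 0 < x) :
    HasDerivAt (fun x : ℝ => x ^ s * Real.exp (c * x ^ p))
      (x ^ (s + p - 1) * Real.exp (c * x ^ p) * (c * p + s * x ^ (-p))) x := by
  refine ((Real.hasDerivAt_rpow_const (p := s) (Or.inl hx.ne')).mul
    ((Real.hasDerivAt_rpow_const (p := p) (Or.inl hx.ne')).const_mul c).exp).congr_deriv ?_
  have h₁ : x ^ (s + p - 1) = x ^ s * x ^ (p - 1) := by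
    rw [← Real.rpow_add hx]; ring_nf
  have h₂ : x ^ (s - 1) = x ^ s * x ^ (p - 1) * x ^ (-p) := by
    rw [← Real.rpow_add hx, ← Real.rpow_add hx]; ring_nf
  rw [h₁, h₂]
  ring

theorem hasDerivAt_integral_rpow_mul_exp_mul_rpow (s c p : ℝ) {a y : ℝ} (ha : 0 < a)
    (hy : 0 < y) :
    HasDerivAt (fun y : ℝ => ∫ x in a..y, x ^ s * Real.exp (c * x ^ p))
      (y ^ s * Real.exp (c * y ^ p)) y := by
  have hcont : ContinuousOn (fun x : ℝ => x ^ s * Real.exp (c * x ^ p)) (Set.Ioi 0) :=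
    fun x hx => (hasDerivAt_rpow_mul_exp_mul_rpow s c p hx).continuousAt.continuousWithinAt
  refine intervalIntegral.integral_hasDerivAt_right ?_
    (hcont.stronglyMeasurableAtFilter isOpen_Ioi y hy)
    (hcont.continuousAt (Ioi_mem_nhds hy))
  exact (hcont.mono fun x hx => (lt_min ha hy).trans_le hx.1).intervalIntegrable

/-- The integral of `x ^ (s + p - 1) * exp (c * x ^ p)` is asymptotic to
`x ^ s * exp (c * x ^ p) / (c * p)`. -/
theorem tendsto_integral_rpow_mul_exp_mul_rpow_div (s : ℝ) {c p a : ℝ} (hc : 0 < c) (hp : 0 < p)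
    (ha : 0 < a) :
    Tendsto (fun y : ℝ => (∫ x in a..y, x ^ (s + p - 1) * Real.exp (c * x ^ p)) /
      (y ^ s * Real.exp (c * y ^ p))) atTop (nhds (1 / (c * p))) := by
  have hcp : 0 < c * p := mul_pos hc hp
  have hpow : Tendsto (fun x : ℝ => x ^ (-p)) atTop (nhds 0) := tendsto_rpow_neg_atTop hp
  have hfactor : ∀ᶠ x : ℝ in atTop, c * p / 2 < c * p + s * x ^ (-p) := by
    have h : Tendsto (fun x : ℝ => c * p + s * x ^ (-p)) atTop (nhds (c * p)) := by
      simpa using (hpow.const_mul s).const_add (c * p)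
    exact h.eventually_const_lt (half_lt_self hcp)
  have hdom : (fun x : ℝ => x ^ (s + p - 1) * Real.exp (c * x ^ p)) =O[atTop]
      fun x : ℝ => x ^ (s + p - 1) * Real.exp (c * x ^ p) * (c * p + s * x ^ (-p)) := by
    refine IsBigO.of_bound (c * p / 2)⁻¹ ?_
    filter_upwards [hfactor] with x h
    rw [norm_mul _ (c * p + _), Real.norm_of_nonneg ((half_pos hcp).trans h).le,
      inv_mul_eq_div, le_div_iff₀ (half_pos hcp)]
    exact mul_le_mul_of_nonneg_left h.le (norm_nonneg _)
  have hsmall : (fun x : ℝ => x ^ (s + p - 1) * Real.exp (c * x ^ p) -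
      x ^ (s + p - 1) * Real.exp (c * x ^ p) * (c * p + s * x ^ (-p)) / (c * p)) =o[atTop]
      fun x : ℝ => x ^ (s + p - 1) * Real.exp (c * x ^ p) * (c * p + s * x ^ (-p)) := by
    refine IsLittleO.trans_isBigO ?_ hdom
    have h := (isBigO_refl (fun x : ℝ => x ^ (s + p - 1) * Real.exp (c * x ^ p))
      atTop).mul_isLittleO ((isLittleO_one_iff ℝ).2 hpow)
    refine (h.const_mul_left (-s / (c * p))).congr (fun x => ?_) fun x => mul_one _
    field_simp
    ring
  have hmain := isLittleO_atTop_of_hasDerivAt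
    (f := fun y => (∫ x in a..y, x ^ (s + p - 1) * Real.exp (c * x ^ p)) -
      y ^ s * Real.exp (c * y ^ p) / (c * p))
    (g := fun y => y ^ s * Real.exp (c * y ^ p))
    ((eventually_gt_atTop 0).mono fun x hx =>
      (hasDerivAt_integral_rpow_mul_exp_mul_rpow _ c p ha hx).sub
        ((hasDerivAt_rpow_mul_exp_mul_rpow s c p hx).div_const _))
    ((eventually_gt_atTop 0).mono fun x hx => hasDerivAt_rpow_mul_exp_mul_rpow s c p hx)
    (by
      filter_upwards [hfactor, eventually_gt_atTop 0] with x h hx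
      have := (half_pos hcp).trans h
      positivity)
    hsmall (tendsto_rpow_mul_exp_mul_rpow_atTop s hc hp)
  have hlim := hmain.tendsto_div_nhds_zero.add_const (1 / (c * p))
  rw [zero_add] at hlim
  refine hlim.congr' ?_
  filter_upwards [eventually_gt_atTop 0] with y hy
  have hpos : 0 < y ^ s * Real.exp (c * y ^ p) := by positivity
  field_simp
  ring

/-- Let `0 < δ₁ < 1`, `δ₂ > δ₁`, `c > 0` and `a > 0`, and set
`η = δ₂ − δ₁`. Then
`lim_{y→∞} y^η · exp(−c·y^(1−δ₁)) · ∫_a^y x^(−δ₂) exp(c·x^(1−δ₁)) dx = 1/(c·(1−δ₁))`.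
In particular the ratio `(∫_a^y x^(−δ₂) e^{c·x^(1−δ₁)} dx) / e^{c·y^(1−δ₁)}` is
`O(y^(−(δ₂−δ₁)))` as `y → ∞`. -/
theorem stmt16 (δ₁ δ₂ c a : ℝ) (hδ₁0 : 0 < δ₁) (hδ₁1 : δ₁ < 1) (hδ : δ₁ < δ₂)
    (hc : 0 < c) (ha : 0 < a) (η : ℝ) (hη : η = δ₂ - δ₁) :
    Tendsto
      (fun y : ℝ =>
        y ^ η * Real.exp (-(c * y ^ (1 - δ₁))) *
          ∫ x in a..y, x ^ (-δ₂) * Real.exp (c * x ^ (1 - δ₁)))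
      atTop (nhds (1 / (c * (1 - δ₁)))) ∧
    (fun y : ℝ =>
        (∫ x in a..y, x ^ (-δ₂) * Real.exp (c * x ^ (1 - δ₁))) /
          Real.exp (c * y ^ (1 - δ₁))) =O[atTop]
      fun y : ℝ => y ^ (-(δ₂ - δ₁)) := by
  have hlim : Tendsto
      (fun y : ℝ =>
        y ^ η * Real.exp (-(c * y ^ (1 - δ₁))) *
          ∫ x in a..y, x ^ (-δ₂) * Real.exp (c * x ^ (1 - δ₁)))
      atTop (nhds (1 / (c * (1 - δ₁)))) := by
    have h := tendsto_integral_rpow_mul_exp_mul_rpow_div (-η) hc (sub_pos.2 hδ₁1) ha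
    rw [show -η + (1 - δ₁) - 1 = -δ₂ by rw [hη]; ring] at h
    refine h.congr' ?_
    filter_upwards [eventually_gt_atTop 0] with y hy
    rw [Real.exp_neg, Real.rpow_neg hy.le, div_eq_mul_inv, mul_inv, inv_inv, mul_comm]
  refine ⟨hlim, ?_⟩
  have h := (isBigO_refl (fun y : ℝ => y ^ (-(δ₂ - δ₁))) atTop).mul (hlim.isBigO_one ℝ)
  refine h.congr' ?_ (Eventually.of_forall fun y => mul_one _)
  filter_upwards [eventually_gt_atTop 0] with y hy
  have hpow : y ^ (δ₂ - δ₁) ≠ 0 := (Real.rpow_pos_of_pos hy _).ne'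
  rw [hη, Real.exp_neg, Real.rpow_neg hy.le, div_eq_inv_mul, mul_assoc,
    inv_mul_cancel_left₀ hpow]
end

section
/- Let N ≥ 1 be an integer, l > 0, and let (β_k)_{k∈ℕ} be a nonnegative real sequence with Σ_{k} β_k = ∞ and Σ_{k} β_k² < ∞. Let e_i(k) ≥ 0 for i ∈ {1,…,N} and k ∈ ℕ be nonnegative reals satisfying, for every k, Σ_{i=1}^N e_i(k+1)² ≤ Σ_{i=1}^N e_i(k)² + 4N l² β_k² + 4l β_k Σ_{i=1}^N e_i(k), and suppose Σ_{k} β_k ( Σ_{i=1}^N e_i(k) ) < ∞. Then lim_{k→∞} e_i(k) = 0 for every i ∈ {1,…,N}. -/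
open Filter

/-- A nonnegative sequence whose increments are bounded above by a summable nonnegative sequence
converges. -/
theorem exists_tendsto_of_le_add_summable {V a : ℕ → ℝ} (hV : ∀ k, 0 ≤ V k) (ha : ∀ k, 0 ≤ a k)
    (hle : ∀ k, V (k + 1) ≤ V k + a k) (hsum : Summable a) :
    ∃ L, Tendsto V atTop (nhds L) := by
  have hanti : Antitone fun n => V n - ∑ k ∈ Finset.range n, a k := by
    refine antitone_nat_of_succ_le fun n => ?_
    rw [Finset.sum_range_succ]
    linarith [hle n]
  have hbdd : BddBelow (Set.range fun n => V n - ∑ k ∈ Finset.range n, a k) := by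
    refine ⟨-∑' k, a k, ?_⟩
    rintro _ ⟨n, rfl⟩
    have := hsum.sum_le_tsum (Finset.range n) fun k _ => ha k
    dsimp only
    linarith [hV n]
  exact ⟨_, by simpa using
    (tendsto_atTop_ciInf hanti hbdd).add hsum.hasSum.tendsto_sum_nat⟩

/-- If `β ≥ 0` has summable product with `S`, and `S` is eventually at least `c > 0`, then `β` is
summable. -/
theorem summable_of_summable_mul_of_eventually_le {β S : ℕ → ℝ} {c : ℝ} (hc : 0 < c)
    (hβ : ∀ k, 0 ≤ β k) (hS : ∀ᶠ k in atTop, c ≤ S k) (hsum : Summable fun k => β k * S k) :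
    Summable β := by
  refine (hsum.mul_left c⁻¹).of_norm_bounded_eventually_nat ?_
  filter_upwards [hS] with k hk
  rw [Real.norm_of_nonneg (hβ k), inv_mul_eq_div, le_div_iff₀ hc]
  exact mul_le_mul_of_nonneg_left hk (hβ k)

/-- Let `N ≥ 1`, `l > 0`, and let `(β_k)` be a nonnegative real sequence with
`Σ β_k = ∞` and `Σ β_k² < ∞`.  Let `e i k ≥ 0` satisfy, for every `k`,
`Σ_i e i (k+1)² ≤ Σ_i e i k² + 4Nl²β_k² + 4lβ_k Σ_i e i k`, and suppose
`Σ_k β_k (Σ_i e i k) < ∞`.  Then `lim_{k→∞} e i k = 0` for every `i`. -/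
theorem stmt17 (N : ℕ) (hN : 1 ≤ N) (l : ℝ) (hl : 0 < l)
    (β : ℕ → ℝ) (hβ0 : ∀ k, 0 ≤ β k)
    (hβdiv : Tendsto (fun n => ∑ k ∈ Finset.range n, β k) atTop atTop)
    (hβ2 : Summable fun k => β k ^ 2)
    (e : Fin N → ℕ → ℝ) (he0 : ∀ i k, 0 ≤ e i k)
    (hrec : ∀ k, ∑ i, e i (k + 1) ^ 2 ≤
      ∑ i, e i k ^ 2 + 4 * N * l ^ 2 * β k ^ 2 + 4 * l * β k * ∑ i, e i k)
    (hsum : Summable fun k => β k * ∑ i, e i k) :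
    ∀ i, Tendsto (fun k => e i k) atTop (nhds 0) := by
  have hS : ∀ k, 0 ≤ ∑ i, e i k := fun k => Finset.sum_nonneg fun i _ => he0 i k
  have hV : ∀ k, 0 ≤ ∑ i, e i k ^ 2 := fun k => Finset.sum_nonneg fun i _ => sq_nonneg _
  obtain ⟨L, hL⟩ := exists_tendsto_of_le_add_summable (V := fun k => ∑ i, e i k ^ 2)
    (a := fun k => 4 * N * l ^ 2 * β k ^ 2 + 4 * l * (β k * ∑ i, e i k)) hV
    (fun k => by have := hβ0 k; have := hS k; positivity)
    (fun k => by linarith [hrec k])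
    ((hβ2.mul_left _).add (hsum.mul_left _))
  have hL0 : L = 0 := by
    refine le_antisymm (not_lt.mp fun hpos => ?_) (ge_of_tendsto' hL hV)
    have hlow : ∀ᶠ k in atTop, √(L / 2) ≤ ∑ i, e i k := by
      filter_upwards [hL.eventually (eventually_ge_nhds (half_lt_self hpos))] with k hk
      exact (Real.sqrt_le_left (hS k)).mpr
        (hk.trans (Finset.sum_sq_le_sq_sum_of_nonneg fun i _ => he0 i k))
    exact (not_summable_iff_tendsto_nat_atTop_of_nonneg hβ0).mpr hβdiv
      (summable_of_summable_mul_of_eventually_le (Real.sqrt_pos.mpr (half_pos hpos)) hβ0 hlow hsum)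
  subst hL0
  intro i
  have hsq : Tendsto (fun k => e i k ^ 2) atTop (nhds 0) :=
    squeeze_zero (fun k => sq_nonneg _)
      (fun k => Finset.single_le_sum (f := fun j => e j k ^ 2) (fun j _ => sq_nonneg _)
        (Finset.mem_univ i)) hL
  simpa [Real.sqrt_sq (he0 i _)] using hsq.sqrt
end

section
/- Let f₁, …, f_N : ℝⁿ → ℝ be convex functions such that for every j and every point w ∈ ℝⁿ the subdifferential ∂f_j(w) is nonempty and every element of ∂f_j(w) has norm at most l, where l > 0; set f = Σ_{j=1}^N f_j. Let y, x, x₁, …, x_N ∈ ℝⁿ, let d_j ∈ ∂f_j(x_j) for each j, let β ≥ 0, and set y⁺ = y − (β/N) Σ_{j=1}^N d_j. Then ‖y⁺ − x‖² ≤ ‖y − x‖² − (2β/N)·(f(y) − f(x)) + (4lβ/N)·Σ_{j=1}^N ‖y − x_j‖ + β² l². -/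
open RealInnerProductSpace

/-- The subdifferential of `f : ℝⁿ → ℝ` at `z`:  `g ∈ ∂f(z)` iff
`f w ≥ f z + ⟪g, w − z⟫` for all `w`. -/
def subdiff {n : ℕ} (f : EuclideanSpace ℝ (Fin n) → ℝ) (z : EuclideanSpace ℝ (Fin n)) :
    Set (EuclideanSpace ℝ (Fin n)) :=
  {g | ∀ w, f z + ⟪g, w - z⟫ ≤ f w}

/-- If the subgradients of `f` at `y` and the subgradient `d` at `z` are bounded by `l`, then
`d` acts at `y` as a subgradient up to the error `2 l ‖y - z‖`. -/
theorem sub_le_inner_add_of_mem_subdiff {n : ℕ} {f : EuclideanSpace ℝ (Fin n) → ℝ} {l : ℝ}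
    {x y z g d : EuclideanSpace ℝ (Fin n)} (hg : g ∈ subdiff f y) (hgl : ‖g‖ ≤ l)
    (hd : d ∈ subdiff f z) (hdl : ‖d‖ ≤ l) :
    f y - f x ≤ ⟪d, y - x⟫ + 2 * l * ‖y - z‖ := by
  have h₁ : f y + ⟪g, z - y⟫ ≤ f z := hg z
  have h₂ : f z + ⟪d, x - z⟫ ≤ f x := hd x
  have h₃ : ⟪g, y - z⟫ ≤ l * ‖y - z‖ := (real_inner_le_norm _ _).trans (by gcongr)
  have h₄ : ⟪d, z - y⟫ ≤ l * ‖y - z‖ :=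
    (real_inner_le_norm _ _).trans (by rw [norm_sub_rev]; gcongr)
  simp only [inner_sub_right] at *
  linarith

/-- Basic descent inequality for the averaged iterate: with
`y⁺ = y − (β/N) Σ_j d_j`, `d_j ∈ ∂f_j(x_j)`, subgradients bounded by `l`, one has
`‖y⁺ − x‖² ≤ ‖y − x‖² − (2β/N)(f(y) − f(x)) + (4lβ/N) Σ_j ‖y − x_j‖ + β²l²`. -/
theorem stmt19 {n N : ℕ} (l : ℝ) (hl : 0 < l)
    (f : Fin N → EuclideanSpace ℝ (Fin n) → ℝ)
    (hconv : ∀ j, ConvexOn ℝ Set.univ (f j))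
    (hne : ∀ j w, (subdiff (f j) w).Nonempty)
    (hbd : ∀ j w g, g ∈ subdiff (f j) w → ‖g‖ ≤ l)
    (y x : EuclideanSpace ℝ (Fin n)) (xv : Fin N → EuclideanSpace ℝ (Fin n))
    (d : Fin N → EuclideanSpace ℝ (Fin n)) (hd : ∀ j, d j ∈ subdiff (f j) (xv j))
    (β : ℝ) (hβ : 0 ≤ β) :
    ‖(y - (β / N) • ∑ j, d j) - x‖ ^ 2 ≤
      ‖y - x‖ ^ 2 - (2 * β / N) * ((∑ j, f j y) - ∑ j, f j x)
        + (4 * l * β / N) * ∑ j, ‖y - xv j‖ + β ^ 2 * l ^ 2 := by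
  have hdl : ∀ j, ‖d j‖ ≤ l := fun j => hbd j _ _ (hd j)
  have hdescent : (∑ j, f j y) - ∑ j, f j x ≤ ⟪∑ j, d j, y - x⟫ + 2 * l * ∑ j, ‖y - xv j‖ := by
    rw [← Finset.sum_sub_distrib, sum_inner, Finset.mul_sum, ← Finset.sum_add_distrib]
    refine Finset.sum_le_sum fun j _ => ?_
    obtain ⟨g, hg⟩ := hne j y
    exact sub_le_inner_add_of_mem_subdiff hg (hbd j y g hg) (hd j) (hdl j)
  have hstep : ‖(β / N) • ∑ j, d j‖ ≤ β * l := by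
    have hsum : ‖∑ j, d j‖ ≤ N * l := by
      simpa using norm_sum_le_of_le Finset.univ fun j _ => hdl j
    rw [norm_smul, Real.norm_of_nonneg (by positivity)]
    calc β / N * ‖∑ j, d j‖ ≤ β / N * (N * l) := by gcongr
      _ = β * l * (N / N) := by ring
      _ ≤ β * l := mul_le_of_le_one_right (by positivity) (div_self_le_one _)
  have hsq : ‖(β / N) • ∑ j, d j‖ ^ 2 ≤ β ^ 2 * l ^ 2 := by
    rw [← mul_pow]; gcongr
  have hscaled := mul_le_mul_of_nonneg_left hdescent (show 0 ≤ 2 * β / N by positivity)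
  rw [sub_right_comm, norm_sub_sq_real, real_inner_smul_right, real_inner_comm]
  linear_combination hsq + hscaled
end
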